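/- Let T = T_1 ∨ T_2 be the wedge product of two plane rooted trees T_1 and T_2 (identified at their common root). Then Q(T) = (|E(T)| choose |E(T_1)|, |E(T_2)|)_q · Q(T_1) · Q(T_2), where |E(T)| = |E(T_1)| + |E(T_2)|. -/

import Mathlib

/-- A plane rooted tree: a root with an ordered list of plane rooted subtrees. -/
inductive PTree : Type where
  | node : List PTree → PTree

namespace PTree

mutual
/-- Number of edges of a plane rooted tree. -/
def edges : PTree → ℕ
  | .node l => edgesL l
def edgesL : List PTree → ℕ
  | [] => 0
  | t :: ts => (edges t + 1) + edgesL ts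
end

mutual
/-- Number of vertices of a plane rooted tree. -/
def vertices : PTree → ℕ
  | .node l => 1 + verticesL l
def verticesL : List PTree → ℕ
  | [] => 0
  | t :: ts => vertices t + verticesL ts
end

mutual
/-- `plucks T` is the list, indexed by the leaves `v` of `T`, of the pairs
`(r(T,v), T - v)`, where `r(T,v)` is the number of vertices strictly to the
right of the path from `v` to the root, and `T - v` is `T` with the leaf `v`
(and its edge) deleted. -/
def plucks : PTree → List (ℕ × PTree)
  | .node l => (plucksL l).map (fun p => (p.1, PTree.node p.2))
def plucksL : List PTree → List (ℕ × List PTree)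
  | [] => []
  | t :: ts =>
      (match t with
       | .node [] => [(verticesL ts, ts)]
       | .node (s :: ss) =>
          (plucks (.node (s :: ss))).map (fun p => (p.1 + verticesL ts, p.2 :: ts)))
      ++ (plucksL ts).map (fun p => (p.1, t :: p.2))
end

/-- The plucking polynomial, computed with a fuel parameter (the fuel is the
number of edges; each plucking removes exactly one edge). -/
noncomputable def Qfuel : ℕ → PTree → Polynomial ℤ
  | 0, _ => 1
  | (k+1), t =>
      if edges t = 0 then 1
      else ((plucks t).map (fun p => Polynomial.X ^ p.1 * Qfuel k p.2)).sum

/-- The plucking polynomial `Q(T)` of a plane rooted tree: `Q(T) = 1` if `T` has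
no edges, and otherwise `Q(T) = Σ_v q^{r(T,v)} Q(T - v)`, summed over the leaves of `T`. -/
noncomputable def Q (t : PTree) : Polynomial ℤ := Qfuel (edges t) t

end PTree

/-- The `q`-analogue `[a]_q = 1 + q + ⋯ + q^{a-1}`. -/
noncomputable def qInt (a : ℕ) : Polynomial ℤ := (Finset.range a).sum (fun i => Polynomial.X ^ i)

/-- The `q`-factorial `[a]_q! = [1]_q [2]_q ⋯ [a]_q`. -/
noncomputable def qFact : ℕ → Polynomial ℤ
  | 0 => 1
  | (a+1) => qFact a * qInt (a+1)

/-- The `q`-multinomial coefficient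
`(a₁+⋯+a_k choose a₁,…,a_k)_q = [a₁+⋯+a_k]_q! / ([a₁]_q! ⋯ [a_k]_q!)`
(the division, by a monic polynomial, is exact). -/
noncomputable def qMultinomial (l : List ℕ) : Polynomial ℤ :=
  qFact l.sum /ₘ (l.map qFact).prod

/-- The Gaussian binomial coefficient `(a+c choose a)_q`. -/
noncomputable def qBinom (a c : ℕ) : Polynomial ℤ := qMultinomial [a, c]

namespace PTree

theorem edgesL_append (l m : List PTree) : edgesL (l ++ m) = edgesL l + edgesL m := by
  induction l with
  | nil => simp [edgesL]
  | cons t ts ih => simp [edgesL, ih]; omega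

mutual
theorem vertices_eq_edges_add_one : ∀ t : PTree, vertices t = edges t + 1
  | .node l => by rw [vertices, edges, verticesL_eq_edgesL l, add_comm]
theorem verticesL_eq_edgesL : ∀ l : List PTree, verticesL l = edgesL l
  | [] => by rw [verticesL, edgesL]
  | t :: ts => by
      rw [verticesL, edgesL, vertices_eq_edges_add_one t, verticesL_eq_edgesL ts]
end

mutual
theorem edges_of_mem_plucks :
    ∀ (t : PTree) (p : ℕ × PTree), p ∈ plucks t → edges p.2 + 1 = edges t
  | .node l, p, hp => by
      rw [plucks, List.mem_map] at hp
      obtain ⟨a, ha, rfl⟩ := hp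
      simpa only [edges] using edgesL_of_mem_plucksL l a ha
theorem edgesL_of_mem_plucksL :
    ∀ (l : List PTree) (p : ℕ × List PTree), p ∈ plucksL l → edgesL p.2 + 1 = edgesL l
  | [], p, hp => by simp [plucksL] at hp
  | .node [] :: ts, p, hp => by
      simp only [plucksL, List.mem_append, List.mem_singleton, List.mem_map] at hp
      rcases hp with rfl | ⟨a, ha, rfl⟩
      · simp only [edgesL, edges]; omega
      · have := edgesL_of_mem_plucksL ts a ha
        simp only [edgesL, edges]; omega
  | .node (s :: ss) :: ts, p, hp => by
      rw [plucksL, List.mem_append] at hp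
      rcases hp with hp | hp
      · obtain ⟨a, ha, rfl⟩ := List.mem_map.1 hp
        have := edges_of_mem_plucks (.node (s :: ss)) a ha
        rw [edgesL, edgesL]; omega
      · obtain ⟨a, ha, rfl⟩ := List.mem_map.1 hp
        have := edgesL_of_mem_plucksL ts a ha
        rw [edgesL, edgesL]; omega
end

theorem plucksL_append (l m : List PTree) :
    plucksL (l ++ m) = (plucksL l).map (fun p => (p.1 + edgesL m, p.2 ++ m)) ++
      (plucksL m).map (fun p => (p.1, l ++ p.2)) := by
  induction l with
  | nil => simp [plucksL]
  | cons t ts ih =>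
    rcases t with ⟨_ | ⟨s, ss⟩⟩ <;>
    simp [plucksL, ih, verticesL_eq_edgesL, edgesL_append, Function.comp_def, add_assoc]

theorem Q_node_nil : Q (.node []) = 1 := by
  simp [Q, edges, edgesL, Qfuel]

theorem eq_nil_of_edgesL_eq_zero {l : List PTree} (h : edgesL l = 0) : l = [] := by
  cases l with
  | nil => rfl
  | cons t ts => rw [edgesL] at h; omega

theorem Q_node_eq_sum {l : List PTree} (h : edgesL l ≠ 0) :
    Q (.node l) =
      ((plucksL l).map (fun p => Polynomial.X ^ p.1 * Q (.node p.2))).sum := by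
  obtain ⟨k, hk⟩ := Nat.exists_eq_succ_of_ne_zero h
  rw [Q, edges, hk, Nat.succ_eq_add_one, Qfuel, edges, if_neg h, plucks, List.map_map]
  congr 1
  refine List.map_congr_left fun p hp => ?_
  have := edgesL_of_mem_plucksL l p hp
  have hk' : edgesL p.2 = k := by omega
  simp only [Function.comp_apply, Q, edges, hk']

end PTree

theorem qInt_add (a b : ℕ) : qInt (a + b) = Polynomial.X ^ b * qInt a + qInt b := by
  simp only [qInt]
  rw [add_comm a b, Finset.sum_range_add, Finset.mul_sum, add_comm]
  simp only [pow_add]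

theorem qFact_monic (a : ℕ) : (qFact a).Monic := by
  induction a with
  | zero => exact Polynomial.monic_one
  | succ a ih => exact ih.mul (Polynomial.monic_geom_sum_X a.succ_ne_zero)

theorem qFact_mul_qFact_dvd : ∀ a b : ℕ, qFact a * qFact b ∣ qFact (a + b)
  | 0, b => by simp [qFact]
  | a + 1, 0 => by simp [qFact]
  | a + 1, b + 1 => by
    obtain ⟨c, hc⟩ := qFact_mul_qFact_dvd a (b + 1)
    obtain ⟨d, hd⟩ := qFact_mul_qFact_dvd (a + 1) b
    have hc' : qFact (a + b + 1) = qFact a * qFact (b + 1) * c := hc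
    have hd' : qFact (a + b + 1) = qFact (a + 1) * qFact b * d := by
      rw [← hd]; congr 1; omega
    refine ⟨Polynomial.X ^ (b + 1) * c + d, ?_⟩
    have h : qFact (a + 1 + (b + 1)) =
        qFact (a + b + 1) * (Polynomial.X ^ (b + 1) * qInt (a + 1) + qInt (b + 1)) := by
      rw [← qInt_add, show a + 1 + (b + 1) = a + b + 1 + 1 by omega, qFact]
    rw [h, mul_add]
    nth_rewrite 1 [hc']
    rw [hd', qFact, qFact]
    ring

theorem qMultinomial_pair_mul (a b : ℕ) :
    qFact a * qFact b * qMultinomial [a, b] = qFact (a + b) := by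
  obtain ⟨c, hc⟩ := qFact_mul_qFact_dvd a b
  have hm := (qFact_monic a).mul (qFact_monic b)
  simp only [qMultinomial, List.sum_cons, List.sum_nil, List.map_cons, List.map_nil,
    List.prod_cons, List.prod_nil, add_zero, mul_one]
  rw [hc, Polynomial.mul_divByMonic_cancel_left _ hm]

namespace PTree

theorem qFact_mul_Q_append (n : ℕ) : ∀ l m : List PTree, edgesL l + edgesL m = n →
    qFact (edgesL l) * qFact (edgesL m) * Q (.node (l ++ m)) =
      qFact n * Q (.node l) * Q (.node m) := by
  induction n with
  | zero =>
    intro l m h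
    obtain rfl := eq_nil_of_edgesL_eq_zero (l := l) (by omega)
    obtain rfl := eq_nil_of_edgesL_eq_zero (l := m) (by omega)
    simp [edgesL, qFact, Q_node_nil]
  | succ n ih =>
    intro l m h
    by_cases hl : edgesL l = 0
    · obtain rfl := eq_nil_of_edgesL_eq_zero hl
      rw [← h]
      simp [edgesL, qFact, Q_node_nil]
    by_cases hm : edgesL m = 0
    · obtain rfl := eq_nil_of_edgesL_eq_zero hm
      rw [← h]
      simp [edgesL, qFact, Q_node_nil]
    obtain ⟨a, ha⟩ := Nat.exists_eq_succ_of_ne_zero hl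
    obtain ⟨b, hb⟩ := Nat.exists_eq_succ_of_ne_zero hm
    rw [Nat.succ_eq_add_one] at ha hb
    have hleft : qFact a * qFact (b + 1) * ((plucksL l).map (fun p =>
          Polynomial.X ^ (p.1 + (b + 1)) * Q (.node (p.2 ++ m)))).sum =
        Polynomial.X ^ (b + 1) * qFact n * Q (.node l) * Q (.node m) := by
      rw [Q_node_eq_sum hl, ← List.sum_map_mul_left, ← List.sum_map_mul_left,
        ← List.sum_map_mul_right]
      congr 1
      refine List.map_congr_left fun p hp => ?_
      have hp' := edgesL_of_mem_plucksL l p hp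
      have := ih p.2 m (by omega)
      rw [show edgesL p.2 = a by omega, hb] at this
      linear_combination Polynomial.X ^ (p.1 + (b + 1)) * this
    have hright : qFact (a + 1) * qFact b * ((plucksL m).map (fun p =>
          Polynomial.X ^ p.1 * Q (.node (l ++ p.2)))).sum =
        qFact n * Q (.node l) * Q (.node m) := by
      rw [Q_node_eq_sum hm, ← List.sum_map_mul_left, ← List.sum_map_mul_left]
      congr 1
      refine List.map_congr_left fun p hp => ?_
      have hp' := edgesL_of_mem_plucksL m p hp
      have := ih l p.2 (by omega)
      rw [show edgesL p.2 = b by omega, ha] at this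
      linear_combination Polynomial.X ^ p.1 * this
    have hq : qInt (n + 1) = Polynomial.X ^ (b + 1) * qInt (a + 1) + qInt (b + 1) := by
      rw [← qInt_add]; congr 1; omega
    have hlm : edgesL (l ++ m) ≠ 0 := by rw [edgesL_append]; omega
    rw [Q_node_eq_sum hlm, plucksL_append, List.map_append, List.sum_append, List.map_map,
      List.map_map, ha, hb]
    simp only [Function.comp_def]
    rw [qFact] at hleft hright ⊢
    rw [qFact, qFact, hq]
    linear_combination qInt (a + 1) * hleft + qInt (b + 1) * hright

end PTree

/-- **Wedge product formula for two trees.** For plane rooted trees `T₁ = node L₁` and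
`T₂ = node L₂`, the wedge product `T = T₁ ∨ T₂ = node (L₁ ++ L₂)` (identification at the
common root) satisfies
`Q(T) = (|E(T)| choose |E(T₁)|, |E(T₂)|)_q · Q(T₁) · Q(T₂)`, where
`|E(T)| = |E(T₁)| + |E(T₂)|`. -/
theorem plucking_wedge_two (L₁ L₂ : List PTree) :
    PTree.edges (.node (L₁ ++ L₂)) = PTree.edges (.node L₁) + PTree.edges (.node L₂) ∧
    PTree.Q (.node (L₁ ++ L₂)) =
      qMultinomial [PTree.edges (.node L₁), PTree.edges (.node L₂)] *
        PTree.Q (.node L₁) * PTree.Q (.node L₂) := by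
  simp only [PTree.edges]
  refine ⟨PTree.edgesL_append L₁ L₂, ?_⟩
  have hm := (qFact_monic (PTree.edgesL L₁)).mul (qFact_monic (PTree.edgesL L₂))
  refine mul_left_cancel₀ hm.ne_zero ?_
  rw [PTree.qFact_mul_Q_append _ L₁ L₂ rfl, ← qMultinomial_pair_mul]
  ring
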